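/- (Lemma 4.2, first estimate) Let (u,v,z) be a classical solution of the transmission system, let q be the piecewise function q(x) = x − L₁/2 on [0,L₁], q(x) = ((L₂−L₃−L₁)/(2(L₂−L₁)))(x − L₁) + L₁/2 on [L₁,L₂], q(x) = x − (L₂+L₃)/2 on [L₂,L₃], and set M = max{L₁/2, (L₃−L₂)/2} and I₂(t) = −∫_Ω q(x) u_x u_t dx. Then for every ε₂ > 0 and every t > 0, d/dt I₂(t) ≤ ( 1/2 + 1/(2ε₂) ) ∫_Ω u_t² dx + ( a/2 + M² μ₁(0)² ε₂ ) ∫_Ω u_x² dx + (β²/(2ε₂)) ∫_Ω z(x,1,t)² dx − (1/4)[ L₁ u_t(L₁,t)² + (L₃−L₂) u_t(L₂,t)² ] − (a/4)[ L₁ u_x(L₁,t)² + (L₃−L₂) u_x(L₂,t)² ]. -/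

import Mathlib

open Set Real MeasureTheory intervalIntegral

noncomputable section

/-- The closed damped region `Ω̄ = [0,L₁] ∪ [L₂,L₃]`. -/
def Omegac (L1 L2 L3 : ℝ) : Set ℝ := Set.Icc 0 L1 ∪ Set.Icc L2 L3

/-- The open damped region `Ω = (0,L₁) ∪ (L₂,L₃)`. -/
def Omegao (L1 L2 L3 : ℝ) : Set ℝ := Set.Ioo 0 L1 ∪ Set.Ioo L2 L3

/-- Data and standing hypotheses for the transmission problem for waves with
time-varying delay and nonlinear weights. -/
structure TransmissionSystem where
  L1 : ℝ
  L2 : ℝ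
  L3 : ℝ
  a : ℝ
  b : ℝ
  τ0 : ℝ
  τ1 : ℝ
  d : ℝ
  M1 : ℝ
  M2 : ℝ
  β : ℝ
  τ : ℝ → ℝ
  τ' : ℝ → ℝ
  μ1 : ℝ → ℝ
  μ1' : ℝ → ℝ
  μ2 : ℝ → ℝ
  μ2' : ℝ → ℝ
  hL1 : 0 < L1
  hL12 : L1 < L2
  hL23 : L2 < L3
  ha : 0 < a
  hb : 0 < b
  hτ0 : 0 < τ0
  hτderiv : ∀ t ∈ Set.Ici (0:ℝ), HasDerivAt τ (τ' t) t
  hτ'cont : ContinuousOn τ' (Set.Ici 0)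
  hτlb : ∀ t ∈ Set.Ici (0:ℝ), τ0 ≤ τ t
  hτub : ∀ t ∈ Set.Ici (0:ℝ), τ t ≤ τ1
  hd : d < 1
  hτ'le : ∀ t ∈ Set.Ici (0:ℝ), τ' t ≤ d
  hμ1pos : ∀ t ∈ Set.Ici (0:ℝ), 0 < μ1 t
  hμ1anti : AntitoneOn μ1 (Set.Ici 0)
  hμ1deriv : ∀ t ∈ Set.Ici (0:ℝ), HasDerivAt μ1 (μ1' t) t
  hμ1'cont : ContinuousOn μ1' (Set.Ici 0)
  hM1pos : 0 < M1
  hM1 : ∀ t ∈ Set.Ici (0:ℝ), |μ1' t / μ1 t| ≤ M1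
  hμ2deriv : ∀ t ∈ Set.Ici (0:ℝ), HasDerivAt μ2 (μ2' t) t
  hμ2'cont : ContinuousOn μ2' (Set.Ici 0)
  hβpos : 0 < β
  hβ : β < Real.sqrt (1 - d)
  hμ2bd : ∀ t ∈ Set.Ici (0:ℝ), |μ2 t| ≤ β * μ1 t
  hM2pos : 0 < M2
  hμ2'bd : ∀ t ∈ Set.Ici (0:ℝ), |μ2' t| ≤ M2 * μ1 t

/-- A classical solution `(u,v,z)` of the transmission system, recorded together
with its partial derivatives. -/
structure Solution (S : TransmissionSystem) where
  u : ℝ → ℝ → ℝ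
  ux : ℝ → ℝ → ℝ
  uxx : ℝ → ℝ → ℝ
  ut : ℝ → ℝ → ℝ
  utt : ℝ → ℝ → ℝ
  v : ℝ → ℝ → ℝ
  vx : ℝ → ℝ → ℝ
  vxx : ℝ → ℝ → ℝ
  vt : ℝ → ℝ → ℝ
  vtt : ℝ → ℝ → ℝ
  z : ℝ → ℝ → ℝ → ℝ
  zρ : ℝ → ℝ → ℝ → ℝ
  zt : ℝ → ℝ → ℝ → ℝ
  -- u is of class C² on Ω̄ × [0,∞)
  hux : ∀ x ∈ Omegac S.L1 S.L2 S.L3, ∀ t ∈ Set.Ici (0:ℝ),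
    HasDerivAt (fun y => u y t) (ux x t) x
  huxx : ∀ x ∈ Omegac S.L1 S.L2 S.L3, ∀ t ∈ Set.Ici (0:ℝ),
    HasDerivAt (fun y => ux y t) (uxx x t) x
  hut : ∀ x ∈ Omegac S.L1 S.L2 S.L3, ∀ t ∈ Set.Ici (0:ℝ),
    HasDerivAt (fun s => u x s) (ut x t) t
  hutt : ∀ x ∈ Omegac S.L1 S.L2 S.L3, ∀ t ∈ Set.Ici (0:ℝ),
    HasDerivAt (fun s => ut x s) (utt x t) t
  hucont : ContinuousOn (Function.uncurry u) ((Omegac S.L1 S.L2 S.L3) ×ˢ Set.Ici 0)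
  huxcont : ContinuousOn (Function.uncurry ux) ((Omegac S.L1 S.L2 S.L3) ×ˢ Set.Ici 0)
  huxxcont : ContinuousOn (Function.uncurry uxx) ((Omegac S.L1 S.L2 S.L3) ×ˢ Set.Ici 0)
  hutcont : ContinuousOn (Function.uncurry ut) ((Omegac S.L1 S.L2 S.L3) ×ˢ Set.Ici 0)
  huttcont : ContinuousOn (Function.uncurry utt) ((Omegac S.L1 S.L2 S.L3) ×ˢ Set.Ici 0)
  -- v is of class C² on [L₁,L₂] × [0,∞)
  hvx : ∀ x ∈ Set.Icc S.L1 S.L2, ∀ t ∈ Set.Ici (0:ℝ),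
    HasDerivAt (fun y => v y t) (vx x t) x
  hvxx : ∀ x ∈ Set.Icc S.L1 S.L2, ∀ t ∈ Set.Ici (0:ℝ),
    HasDerivAt (fun y => vx y t) (vxx x t) x
  hvt : ∀ x ∈ Set.Icc S.L1 S.L2, ∀ t ∈ Set.Ici (0:ℝ),
    HasDerivAt (fun s => v x s) (vt x t) t
  hvtt : ∀ x ∈ Set.Icc S.L1 S.L2, ∀ t ∈ Set.Ici (0:ℝ),
    HasDerivAt (fun s => vt x s) (vtt x t) t
  hvcont : ContinuousOn (Function.uncurry v) ((Set.Icc S.L1 S.L2) ×ˢ Set.Ici 0)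
  hvxcont : ContinuousOn (Function.uncurry vx) ((Set.Icc S.L1 S.L2) ×ˢ Set.Ici 0)
  hvxxcont : ContinuousOn (Function.uncurry vxx) ((Set.Icc S.L1 S.L2) ×ˢ Set.Ici 0)
  hvtcont : ContinuousOn (Function.uncurry vt) ((Set.Icc S.L1 S.L2) ×ˢ Set.Ici 0)
  hvttcont : ContinuousOn (Function.uncurry vtt) ((Set.Icc S.L1 S.L2) ×ˢ Set.Ici 0)
  -- z is of class C¹ on Ω̄ × [0,1] × [0,∞)
  hzρ : ∀ x ∈ Omegac S.L1 S.L2 S.L3, ∀ ρ ∈ Set.Icc (0:ℝ) 1, ∀ t ∈ Set.Ici (0:ℝ),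
    HasDerivAt (fun r => z x r t) (zρ x ρ t) ρ
  hzt : ∀ x ∈ Omegac S.L1 S.L2 S.L3, ∀ ρ ∈ Set.Icc (0:ℝ) 1, ∀ t ∈ Set.Ici (0:ℝ),
    HasDerivAt (fun s => z x ρ s) (zt x ρ t) t
  hzcont : ContinuousOn (fun p : ℝ × ℝ × ℝ => z p.1 p.2.1 p.2.2)
    ((Omegac S.L1 S.L2 S.L3) ×ˢ ((Set.Icc 0 1) ×ˢ (Set.Ici 0)))
  hzρcont : ContinuousOn (fun p : ℝ × ℝ × ℝ => zρ p.1 p.2.1 p.2.2)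
    ((Omegac S.L1 S.L2 S.L3) ×ˢ ((Set.Icc 0 1) ×ˢ (Set.Ici 0)))
  hztcont : ContinuousOn (fun p : ℝ × ℝ × ℝ => zt p.1 p.2.1 p.2.2)
    ((Omegac S.L1 S.L2 S.L3) ×ˢ ((Set.Icc 0 1) ×ˢ (Set.Ici 0)))
  -- the wave equation with delayed damping on Ω × (0,∞)
  hueq : ∀ x ∈ Omegao S.L1 S.L2 S.L3, ∀ t ∈ Set.Ioi (0:ℝ),
    utt x t = S.a * uxx x t - S.μ1 t * ut x t - S.μ2 t * z x 1 t
  -- the free wave equation on (L₁,L₂) × (0,∞)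
  hveq : ∀ x ∈ Set.Ioo S.L1 S.L2, ∀ t ∈ Set.Ioi (0:ℝ),
    vtt x t = S.b * vxx x t
  -- the transport equation for z on Ω × (0,1) × (0,∞)
  hzeq : ∀ x ∈ Omegao S.L1 S.L2 S.L3, ∀ ρ ∈ Set.Ioo (0:ℝ) 1, ∀ t ∈ Set.Ioi (0:ℝ),
    S.τ t * zt x ρ t + (1 - S.τ' t * ρ) * zρ x ρ t = 0
  -- z(x,0,t) = u_t(x,t)
  hz0 : ∀ x ∈ Omegac S.L1 S.L2 S.L3, ∀ t ∈ Set.Ici (0:ℝ), z x 0 t = ut x t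
  -- transmission conditions
  htrans1 : ∀ t ∈ Set.Ici (0:ℝ), u S.L1 t = v S.L1 t
  htrans2 : ∀ t ∈ Set.Ici (0:ℝ), u S.L2 t = v S.L2 t
  htrans3 : ∀ t ∈ Set.Ici (0:ℝ), S.a * ux S.L1 t = S.b * vx S.L1 t
  htrans4 : ∀ t ∈ Set.Ici (0:ℝ), S.a * ux S.L2 t = S.b * vx S.L2 t
  -- boundary conditions
  hbc0 : ∀ t ∈ Set.Ici (0:ℝ), u 0 t = 0
  hbcL3 : ∀ t ∈ Set.Ici (0:ℝ), u S.L3 t = 0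

/-- The piecewise multiplier `q`. -/
def qfun (L1 L2 L3 x : ℝ) : ℝ :=
  if x ≤ L1 then x - L1 / 2
  else if x ≤ L2 then (L2 - L3 - L1) / (2 * (L2 - L1)) * (x - L1) + L1 / 2
  else x - (L2 + L3) / 2

open Filter Topology

/-- A function continuous on `K × J` restricts to a continuous function of the first variable. -/
lemma continuousOn_slice {K J : Set ℝ} {f : ℝ → ℝ → ℝ}
    (hf : ContinuousOn (Function.uncurry f) (K ×ˢ J)) {t : ℝ} (ht : t ∈ J) :
    ContinuousOn (fun x => f x t) K :=
  hf.comp (f := fun x => (x, t)) (by fun_prop) fun _ hx => ⟨hx, ht⟩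

/-- A function continuous on `[p, r] × [0, ∞)` is bounded on `[p, r] × [0, T]`. -/
lemma exists_bound_on_strip {p r T : ℝ} {f : ℝ → ℝ → ℝ}
    (hf : ContinuousOn (Function.uncurry f) (Icc p r ×ˢ Ici 0)) :
    ∃ K : ℝ, ∀ x ∈ Icc p r, ∀ s ∈ Icc 0 T, |f x s| ≤ K := by
  obtain ⟨K, hK⟩ := (isCompact_Icc.prod isCompact_Icc).exists_bound_of_continuousOn
    (hf.mono (prod_mono subset_rfl (Icc_subset_Ici_self : Icc 0 T ⊆ Ici 0)))
  exact ⟨K, fun x hx s hs => hK (x, s) ⟨hx, hs⟩⟩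

/-- First-order difference quotients are bounded by a bound on the derivative. -/
lemma abs_slope_le {f f' : ℝ → ℝ} {T K t s : ℝ}
    (hf : ∀ σ ∈ Icc 0 T, HasDerivAt f (f' σ) σ) (hK : ∀ σ ∈ Icc 0 T, |f' σ| ≤ K)
    (ht : t ∈ Icc 0 T) (hs : s ∈ Icc 0 T) (hst : s ≠ t) :
    |slope f t s| ≤ K := by
  have h := (convex_Icc 0 T).norm_image_sub_le_of_norm_hasDerivWithin_le
    (fun σ hσ => (hf σ hσ).hasDerivWithinAt) hK ht hs
  rw [slope_def_field, abs_div, div_le_iff₀ (abs_pos.2 (sub_ne_zero.2 hst))]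
  exact h

/-- The second-order remainder of a difference quotient is bounded by a bound on the second
derivative. -/
lemma abs_deriv_sub_slope_div_le {f f' f'' : ℝ → ℝ} {T K t s : ℝ}
    (hf : ∀ σ ∈ Icc 0 T, HasDerivAt f (f' σ) σ)
    (hf' : ∀ σ ∈ Icc 0 T, HasDerivAt f' (f'' σ) σ) (hK : ∀ σ ∈ Icc 0 T, |f'' σ| ≤ K)
    (ht : t ∈ Icc 0 T) (hs : s ∈ Icc 0 T) (hst : s ≠ t) :
    |(f' s - slope f t s) / (s - t)| ≤ K := by
  have hsub : uIcc t s ⊆ Icc 0 T := (ordConnected_Icc).uIcc_subset ht hs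
  have hK0 : 0 ≤ K := (abs_nonneg _).trans (hK t ht)
  have hbound : ∀ σ ∈ uIcc t s, ‖f' σ - f' s‖ ≤ K * |s - t| := fun σ hσ => by
    have h := (convex_uIcc t s).norm_image_sub_le_of_norm_hasDerivWithin_le
      (fun ξ hξ => (hf' ξ (hsub hξ)).hasDerivWithinAt) (fun ξ hξ => hK ξ (hsub hξ))
      right_mem_uIcc hσ
    refine h.trans (mul_le_mul_of_nonneg_left ?_ hK0)
    rw [Real.norm_eq_abs]
    exact abs_sub_right_of_mem_uIcc hσ |>.trans_eq' (abs_sub_comm _ _)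
  have h := (convex_uIcc t s).norm_image_sub_le_of_norm_hasDerivWithin_le
    (f := fun σ => f σ - f' s * σ) (f' := fun σ => f' σ - f' s)
    (fun σ hσ => by
      simpa using! ((hf σ (hsub hσ)).sub ((hasDerivAt_id σ).const_mul (f' s))).hasDerivWithinAt)
    hbound left_mem_uIcc right_mem_uIcc
  have hne : s - t ≠ 0 := sub_ne_zero.2 hst
  have hpos : 0 < |s - t| := abs_pos.2 hne
  have heq : (f' s - slope f t s) / (s - t)
      = -((f s - f' s * s) - (f t - f' s * t)) / ((s - t) * (s - t)) := by
    rw [slope_def_field]; field_simp; ring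
  rw [heq, abs_div, abs_neg, abs_mul, div_le_iff₀ (by positivity), ← mul_assoc]
  exact h

/-- Differentiation in time of `∫ (x - c) u_x u_t dx`. No mixed derivative of `u` is needed: the
difference quotient is rewritten using an exact `x`-derivative of the squared difference quotient
of `u`. -/
lemma hasDerivAt_integral_multiplier {p r c t : ℝ} (hpr : p ≤ r) (ht : 0 < t)
    {u ux ut utt : ℝ → ℝ → ℝ}
    (hux : ∀ x ∈ Icc p r, ∀ s ∈ Ici (0 : ℝ), HasDerivAt (fun y => u y s) (ux x s) x)
    (hut : ∀ x ∈ Icc p r, ∀ s ∈ Ici (0 : ℝ), HasDerivAt (fun σ => u x σ) (ut x s) s)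
    (hutt : ∀ x ∈ Icc p r, ∀ s ∈ Ici (0 : ℝ), HasDerivAt (fun σ => ut x σ) (utt x s) s)
    (huxc : ContinuousOn (Function.uncurry ux) (Icc p r ×ˢ Ici 0))
    (hutc : ContinuousOn (Function.uncurry ut) (Icc p r ×ˢ Ici 0))
    (huttc : ContinuousOn (Function.uncurry utt) (Icc p r ×ˢ Ici 0)) :
    HasDerivAt (fun s => ∫ x in p..r, (x - c) * ux x s * ut x s)
      (((r - c) * ut r t ^ 2 - (p - c) * ut p t ^ 2) / 2
        + ∫ x in p..r, (-(ut x t ^ 2) / 2 + (x - c) * (ux x t * utt x t))) t := by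
  have htI : t ∈ Ici (0 : ℝ) := ht.le
  have htT : t ∈ Icc 0 (t + 1) := ⟨ht.le, by linarith⟩
  obtain ⟨K1, hK1⟩ := exists_bound_on_strip (T := t + 1) huxc
  obtain ⟨K2, hK2⟩ := exists_bound_on_strip (T := t + 1) hutc
  obtain ⟨K3, hK3⟩ := exists_bound_on_strip (T := t + 1) huttc
  obtain ⟨Q, hQ⟩ := isCompact_Icc.exists_bound_of_continuousOn
    (show ContinuousOn (fun x : ℝ => x - c) (Icc p r) by fun_prop)
  have hnear : ∀ᶠ s in 𝓝[≠] t, s ∈ Icc 0 (t + 1) ∧ s ≠ t :=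
    (eventually_nhdsWithin_of_eventually_nhds (Icc_mem_nhds ht (by linarith))).and
      eventually_mem_nhdsWithin
  let H : ℝ → ℝ → ℝ := fun s x => -(slope (u x) t s ^ 2) / 2 + (x - c) *
    ((ux x s - ux x t) * ((ut x s - slope (u x) t s) / (s - t)) + ux x t * slope (ut x) t s)
  have hcont_u : ∀ s ∈ Ici (0 : ℝ), ContinuousOn (fun x => u x s) (Icc p r) := fun s hs x hx =>
    (hux x hx s hs).continuousAt.continuousWithinAt
  have hcont_ux : ∀ s ∈ Ici (0 : ℝ), ContinuousOn (fun x => ux x s) (Icc p r) := fun s hs =>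
    continuousOn_slice huxc hs
  have hcont_ut : ∀ s ∈ Ici (0 : ℝ), ContinuousOn (fun x => ut x s) (Icc p r) := fun s hs =>
    continuousOn_slice hutc hs
  have hcont_A : ∀ s ∈ Ici (0 : ℝ), ContinuousOn (fun x => slope (u x) t s) (Icc p r) :=
    fun s hs => by
      simp only [slope_def_field]
      exact ((hcont_u s hs).sub (hcont_u t htI)).div_const _
  have hcont_H : ∀ s ∈ Ici (0 : ℝ), ContinuousOn (H s) (Icc p r) := fun s hs => by
    have h1 := hcont_A s hs
    have h2 := hcont_ux s hs
    have h3 := hcont_ux t htI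
    have h4 := hcont_ut s hs
    have h5 := hcont_ut t htI
    have h6 : ContinuousOn (fun x => slope (ut x) t s) (Icc p r) := by
      simp only [slope_def_field]
      exact (h4.sub h5).div_const _
    simp only [H]
    fun_prop
  have hlim : Tendsto (fun s => ∫ x in p..r, H s x) (𝓝[≠] t)
      (𝓝 (∫ x in p..r, (-(ut x t ^ 2) / 2 + (x - c) * (ux x t * utt x t)))) := by
    refine tendsto_integral_filter_of_dominated_convergence
      (fun _ => K2 ^ 2 / 2 + Q * ((K1 + K1) * K3 + K1 * K3)) ?_ ?_ (by simp) ?_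
    · filter_upwards [hnear] with s hs
      exact (((hcont_H s hs.1.1).mono (uIcc_of_le hpr).subset).mono
        uIoc_subset_uIcc).aestronglyMeasurable measurableSet_uIoc
    · filter_upwards [hnear] with s hs
      refine Eventually.of_forall fun x hx => ?_
      have hx : x ∈ Icc p r := uIcc_of_le hpr ▸ uIoc_subset_uIcc hx
      have hA := abs_slope_le (fun σ hσ => hut x hx σ hσ.1) (hK2 x hx) htT hs.1 hs.2
      have hB := abs_slope_le (fun σ hσ => hutt x hx σ hσ.1) (hK3 x hx) htT hs.1 hs.2
      have hC := abs_deriv_sub_slope_div_le (fun σ hσ => hut x hx σ hσ.1)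
        (fun σ hσ => hutt x hx σ hσ.1) (hK3 x hx) htT hs.1 hs.2
      have hq : |x - c| ≤ Q := hQ x hx
      have hus := hK1 x hx s hs.1
      have hu0 := hK1 x hx t htT
      have hK1n : 0 ≤ K1 := (abs_nonneg _).trans hu0
      have hK3n : 0 ≤ K3 := (abs_nonneg _).trans hB
      have hQn : 0 ≤ Q := (abs_nonneg _).trans hq
      refine (abs_add_le _ _).trans (add_le_add ?_ ?_)
      · rw [abs_div, abs_neg, abs_pow, abs_two]
        gcongr
      · rw [abs_mul]
        refine mul_le_mul hq ((abs_add_le _ _).trans (add_le_add ?_ ?_)) (abs_nonneg _) hQn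
        · rw [abs_mul]
          exact mul_le_mul ((abs_sub _ _).trans (add_le_add hus hu0)) hC (abs_nonneg _)
            (by positivity)
        · rw [abs_mul]
          exact mul_le_mul hu0 hB (abs_nonneg _) hK1n
    · refine Eventually.of_forall fun x hx => ?_
      have hx : x ∈ Icc p r := uIcc_of_le hpr ▸ uIoc_subset_uIcc hx
      have hA := hasDerivAt_iff_tendsto_slope.1 (hut x hx t htI)
      have hB := hasDerivAt_iff_tendsto_slope.1 (hutt x hx t htI)
      have hΔ : Tendsto (fun s => ux x s - ux x t) (𝓝[≠] t) (𝓝 0) := by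
        have hc : ContinuousOn (fun s => ux x s) (Ici 0) :=
          huxc.comp (f := fun s => (x, s)) (by fun_prop) fun s hs => ⟨hx, hs⟩
        have := (hc.continuousAt (Ici_mem_nhds ht)).tendsto.sub_const (ux x t)
        rw [sub_self] at this
        exact this.mono_left nhdsWithin_le_nhds
      have hΔC : Tendsto (fun s => (ux x s - ux x t) * ((ut x s - slope (u x) t s) / (s - t)))
          (𝓝[≠] t) (𝓝 0) := by
        refine hΔ.zero_mul_isBoundedUnder_le ⟨K3, ?_⟩
        rw [eventually_map]
        filter_upwards [hnear] with s hs
        exact abs_deriv_sub_slope_div_le (fun σ hσ => hut x hx σ hσ.1)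
          (fun σ hσ => hutt x hx σ hσ.1) (hK3 x hx) htT hs.1 hs.2
      simpa [H] using ((hA.pow 2).neg.div_const 2).add
        ((hΔC.add (hB.const_mul (ux x t))).const_mul (x - c))
  have hr : r ∈ Icc p r := right_mem_Icc.2 hpr
  have hp : p ∈ Icc p r := left_mem_Icc.2 hpr
  have hbdry : Tendsto
      (fun s => ((r - c) * slope (u r) t s ^ 2 - (p - c) * slope (u p) t s ^ 2) / 2)
      (𝓝[≠] t) (𝓝 (((r - c) * ut r t ^ 2 - (p - c) * ut p t ^ 2) / 2)) :=
    ((((hasDerivAt_iff_tendsto_slope.1 (hut r hr t htI)).pow 2).const_mul _).sub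
      (((hasDerivAt_iff_tendsto_slope.1 (hut p hp t htI)).pow 2).const_mul _)).div_const _
  rw [hasDerivAt_iff_tendsto_slope]
  refine (hbdry.add hlim).congr' ?_
  filter_upwards [hnear] with s hs
  have hsI : s ∈ Ici (0 : ℝ) := hs.1.1
  have hne : s - t ≠ 0 := sub_ne_zero.2 hs.2
  have hu : uIcc p r = Icc p r := uIcc_of_le hpr
  have hA := hcont_A s hsI
  have hxs := hcont_ux s hsI
  have hxt := hcont_ux t htI
  have hts := hcont_ut s hsI
  have htt := hcont_ut t htI
  let P : ℝ → ℝ := fun x => slope (u x) t s ^ 2 / 2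
    + (x - c) * (slope (u x) t s * ((ux x s - ux x t) / (s - t)))
  have hP : IntervalIntegrable P volume p r :=
    ContinuousOn.intervalIntegrable (by rw [hu]; fun_prop)
  have hFTC : ∫ x in p..r, P x
      = ((r - c) * slope (u r) t s ^ 2 - (p - c) * slope (u p) t s ^ 2) / 2 := by
    rw [integral_eq_sub_of_hasDerivAt (f := fun x => (x - c) * slope (u x) t s ^ 2 / 2) _ hP]
    · ring
    · intro x hx
      rw [hu] at hx
      have hd : HasDerivAt (fun y => slope (u y) t s) ((ux x s - ux x t) / (s - t)) x := by
        simp only [slope_def_field]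
        exact ((hux x hx s hsI).sub (hux x hx t htI)).div_const _
      convert! (((hasDerivAt_id x).sub_const c).mul (hd.pow 2)).div_const 2 using 1
      simp only [P, id_eq, Pi.pow_apply]
      ring
  have hHi : IntervalIntegrable (H s) volume p r :=
    ContinuousOn.intervalIntegrable (by rw [hu]; exact hcont_H s hsI)
  have hIs : IntervalIntegrable (fun x => (x - c) * ux x s * ut x s) volume p r :=
    ContinuousOn.intervalIntegrable (by rw [hu]; fun_prop)
  have hIt : IntervalIntegrable (fun x => (x - c) * ux x t * ut x t) volume p r :=
    ContinuousOn.intervalIntegrable (by rw [hu]; fun_prop)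
  rw [← hFTC, ← intervalIntegral.integral_add hP hHi, slope_def_field,
    ← intervalIntegral.integral_sub hIs hIt, ← intervalIntegral.integral_div]
  refine integral_congr fun x _ => ?_
  simp only [P, H, slope_def_field]
  field_simp
  ring

/-- Pointwise Young inequality for the damping terms tested against the multiplier. -/
lemma young_damping {q M y v w m1 m2 m β ε : ℝ} (hε : 0 < ε) (hq : |q| ≤ M) (hm1 : 0 ≤ m1)
    (hm : m1 ≤ m) (hm2 : |m2| ≤ β * m1) :
    q * y * (m1 * v + m2 * w)
      ≤ 1 / (2 * ε) * v ^ 2 + M ^ 2 * m ^ 2 * ε * y ^ 2 + β ^ 2 / (2 * ε) * w ^ 2 := by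
  have hqM : q ^ 2 ≤ M ^ 2 := sq_le_sq' (abs_le.1 hq).1 (abs_le.1 hq).2
  have hmm : m1 ^ 2 ≤ m ^ 2 := pow_le_pow_left₀ hm1 hm 2
  have hqm : q ^ 2 * m1 ^ 2 ≤ M ^ 2 * m ^ 2 := by gcongr
  have h1 : q * y * (m1 * v) ≤ 1 / (2 * ε) * v ^ 2 + ε / 2 * (q ^ 2 * m1 ^ 2) * y ^ 2 := by
    have : 1 / (2 * ε) * v ^ 2 + ε / 2 * (q ^ 2 * m1 ^ 2) * y ^ 2 - q * y * (m1 * v)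
        = (v - ε * q * m1 * y) ^ 2 / (2 * ε) := by field_simp; ring
    have : 0 ≤ (v - ε * q * m1 * y) ^ 2 / (2 * ε) := by positivity
    linarith
  have h2 : q * y * (m2 * w) ≤ β ^ 2 / (2 * ε) * w ^ 2 + ε / 2 * (q ^ 2 * m1 ^ 2) * y ^ 2 := by
    have hab : q * y * (m2 * w) ≤ (|q| * |y| * m1) * (β * |w|) := by
      calc q * y * (m2 * w) ≤ |q * y * (m2 * w)| := le_abs_self _
        _ = |q| * |y| * |w| * |m2| := by simp only [abs_mul]; ring
        _ ≤ |q| * |y| * |w| * (β * m1) := by gcongr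
        _ = _ := by ring
    have : β ^ 2 / (2 * ε) * |w| ^ 2 + ε / 2 * (|q| ^ 2 * m1 ^ 2) * |y| ^ 2
        - (|q| * |y| * m1) * (β * |w|) = (β * |w| - ε * |q| * m1 * |y|) ^ 2 / (2 * ε) := by
      field_simp; ring
    have : 0 ≤ (β * |w| - ε * |q| * m1 * |y|) ^ 2 / (2 * ε) := by positivity
    simp only [sq_abs] at *
    linarith
  have h3 : ε * (q ^ 2 * m1 ^ 2) * y ^ 2 ≤ ε * (M ^ 2 * m ^ 2) * y ^ 2 := by gcongr
  linarith

/-- The energy-type estimate on one interval `[p, r]`, at a fixed time. -/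
lemma integral_multiplier_le {p r c a m1 m2 m β ε M : ℝ} (hpr : p ≤ r)
    {y y' v v' w : ℝ → ℝ} (hε : 0 < ε) (hq : ∀ x ∈ Icc p r, |x - c| ≤ M) (hm1 : 0 ≤ m1)
    (hm : m1 ≤ m) (hm2 : |m2| ≤ β * m1)
    (hy : ∀ x ∈ Icc p r, HasDerivAt y (y' x) x) (hy' : ContinuousOn y' (Icc p r))
    (hv : ContinuousOn v (Icc p r)) (hv' : ContinuousOn v' (Icc p r))
    (hw : ContinuousOn w (Icc p r))
    (heq : ∀ x ∈ Ioo p r, v' x = a * y' x - m1 * v x - m2 * w x) :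
    -∫ x in p..r, (-(v x ^ 2) / 2 + (x - c) * (y x * v' x))
      ≤ (1 / 2 + 1 / (2 * ε)) * (∫ x in p..r, v x ^ 2)
        + (a / 2 + M ^ 2 * m ^ 2 * ε) * (∫ x in p..r, y x ^ 2)
        + β ^ 2 / (2 * ε) * (∫ x in p..r, w x ^ 2)
        - a / 2 * ((r - c) * y r ^ 2 - (p - c) * y p ^ 2) := by
  have hu : uIcc p r = Icc p r := uIcc_of_le hpr
  have hyc : ContinuousOn y (Icc p r) := fun x hx => (hy x hx).continuousAt.continuousWithinAt
  have hint : ∀ {f : ℝ → ℝ}, ContinuousOn f (Icc p r) → IntervalIntegrable f volume p r :=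
    fun hf => ContinuousOn.intervalIntegrable (by rwa [hu])
  let P : ℝ → ℝ := fun x => a / 2 * (y x ^ 2 + (x - c) * (2 * (y x * y' x)))
  have hP : IntervalIntegrable P volume p r := hint (by fun_prop)
  have hFTC : ∫ x in p..r, P x = a / 2 * ((r - c) * y r ^ 2 - (p - c) * y p ^ 2) := by
    rw [integral_eq_sub_of_hasDerivAt (f := fun x => a / 2 * ((x - c) * y x ^ 2)) _ hP]
    · ring
    · intro x hx
      rw [hu] at hx
      convert! (((hasDerivAt_id x).sub_const c).mul ((hy x hx).pow 2)).const_mul (a / 2) using 1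
      simp only [P, id_eq, Pi.pow_apply]
      ring
  have hsq : ∀ {f : ℝ → ℝ}, ContinuousOn f (Icc p r) → ∀ k : ℝ,
      IntervalIntegrable (fun x => k * f x ^ 2) volume p r := fun hf k =>
    (hint (hf.pow 2)).const_mul k
  have hv2 := hsq hv (1 / 2 + 1 / (2 * ε))
  have hy2 := hsq hyc (a / 2 + M ^ 2 * m ^ 2 * ε)
  have hw2 := hsq hw (β ^ 2 / (2 * ε))
  rw [← hFTC, ← intervalIntegral.integral_neg, ← intervalIntegral.integral_const_mul,
    ← intervalIntegral.integral_const_mul, ← intervalIntegral.integral_const_mul,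
    ← intervalIntegral.integral_add hv2 hy2, ← intervalIntegral.integral_add (hv2.add hy2) hw2,
    ← intervalIntegral.integral_sub ((hv2.add hy2).add hw2) hP]
  refine integral_mono_on_of_le_Ioo hpr (hint (by fun_prop))
    (((hv2.add hy2).add hw2).sub hP) fun x hx => ?_
  have h := young_damping (y := y x) (v := v x) (w := w x) hε (hq x (Ioo_subset_Icc_self hx))
    hm1 hm hm2
  rw [heq x hx]
  simp only [P]
  linarith

lemma qfun_of_le {L1 L2 L3 x : ℝ} (hx : x ≤ L1) : qfun L1 L2 L3 x = x - L1 / 2 := if_pos hx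

lemma qfun_of_ge {L1 L2 L3 x : ℝ} (h12 : L1 < L2) (hx : L2 ≤ x) :
    qfun L1 L2 L3 x = x - (L2 + L3) / 2 := by
  rw [qfun, if_neg (by linarith)]
  split_ifs with h
  · obtain rfl := le_antisymm hx h
    have : L2 - L1 ≠ 0 := by linarith
    field_simp
    ring
  · rfl

namespace Solution

/-- Estimate for the multiplier functional on one component `[p, r]` of `Ω̄`. -/
lemma multiplier_estimate {S : TransmissionSystem} (sol : Solution S) {p r ε t : ℝ} (hpr : p ≤ r)
    (hc : Icc p r ⊆ Omegac S.L1 S.L2 S.L3) (ho : Ioo p r ⊆ Omegao S.L1 S.L2 S.L3)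
    {M : ℝ} (hM : (r - p) / 2 ≤ M) (hε : 0 < ε) (ht : 0 < t) :
    ∃ D, HasDerivAt (fun s => ∫ x in p..r, (x - (p + r) / 2) * sol.ux x s * sol.ut x s) D t ∧
      -D ≤ (1 / 2 + 1 / (2 * ε)) * (∫ x in p..r, sol.ut x t ^ 2)
        + (S.a / 2 + M ^ 2 * S.μ1 0 ^ 2 * ε) * (∫ x in p..r, sol.ux x t ^ 2)
        + S.β ^ 2 / (2 * ε) * (∫ x in p..r, sol.z x 1 t ^ 2)
        - 1 / 4 * (r - p) * (sol.ut r t ^ 2 + sol.ut p t ^ 2)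
        - S.a / 4 * (r - p) * (sol.ux r t ^ 2 + sol.ux p t ^ 2) := by
  have htI : t ∈ Ici (0 : ℝ) := ht.le
  have hsub : Icc p r ×ˢ Ici (0 : ℝ) ⊆ Omegac S.L1 S.L2 S.L3 ×ˢ Ici 0 :=
    prod_mono hc subset_rfl
  refine ⟨_, hasDerivAt_integral_multiplier hpr ht (fun x hx => sol.hux x (hc hx))
    (fun x hx => sol.hut x (hc hx)) (fun x hx => sol.hutt x (hc hx)) (sol.huxcont.mono hsub)
    (sol.hutcont.mono hsub) (sol.huttcont.mono hsub), ?_⟩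
  have hz : ContinuousOn (fun x => sol.z x 1 t) (Icc p r) :=
    sol.hzcont.comp (f := fun x => (x, (1 : ℝ), t)) (by fun_prop)
      fun x hx => ⟨hc hx, ⟨zero_le_one, le_rfl⟩, htI⟩
  have h := integral_multiplier_le (c := (p + r) / 2) (M := M) hpr hε
    (fun x hx => abs_le.2 ⟨by linarith [hx.1], by linarith [hx.2]⟩)
    (S.hμ1pos t htI).le (S.hμ1anti self_mem_Ici htI htI) (S.hμ2bd t htI)
    (fun x hx => sol.huxx x (hc hx) t htI)
    (continuousOn_slice (sol.huxxcont.mono hsub) htI)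
    (continuousOn_slice (sol.hutcont.mono hsub) htI)
    (continuousOn_slice (sol.huttcont.mono hsub) htI) hz
    (fun x hx => sol.hueq x (ho hx) t ht)
  linarith

end Solution

/-- Lemma 4.2, first estimate: the estimate for `I₂(t) = −∫_Ω q(x) u_x u_t dx`,
where `M = max{L₁/2, (L₃−L₂)/2}`. -/
theorem I2_estimate (S : TransmissionSystem) (sol : Solution S) :
    ∀ ε2 : ℝ, 0 < ε2 → ∀ t ∈ Set.Ioi (0:ℝ), ∃ D : ℝ,
      HasDerivAt (fun s : ℝ =>
        -((∫ x in (0:ℝ)..S.L1, qfun S.L1 S.L2 S.L3 x * sol.ux x s * sol.ut x s)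
          + ∫ x in S.L2..S.L3, qfun S.L1 S.L2 S.L3 x * sol.ux x s * sol.ut x s)) D t ∧
      D ≤ (1/2 + 1 / (2 * ε2)) *
            ((∫ x in (0:ℝ)..S.L1, (sol.ut x t)^2)
              + ∫ x in S.L2..S.L3, (sol.ut x t)^2)
          + (S.a / 2 + (max (S.L1 / 2) ((S.L3 - S.L2) / 2))^2 * (S.μ1 0)^2 * ε2) *
            ((∫ x in (0:ℝ)..S.L1, (sol.ux x t)^2)
              + ∫ x in S.L2..S.L3, (sol.ux x t)^2)
          + (S.β^2 / (2 * ε2)) *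
            ((∫ x in (0:ℝ)..S.L1, (sol.z x 1 t)^2)
              + ∫ x in S.L2..S.L3, (sol.z x 1 t)^2)
          - (1/4) * (S.L1 * (sol.ut S.L1 t)^2 + (S.L3 - S.L2) * (sol.ut S.L2 t)^2)
          - (S.a / 4) * (S.L1 * (sol.ux S.L1 t)^2 + (S.L3 - S.L2) * (sol.ux S.L2 t)^2) := by
  intro ε hε t ht
  have h1 := S.hL1
  have h12 := S.hL12
  have h23 := S.hL23
  obtain ⟨D₁, hD₁, hle₁⟩ := sol.multiplier_estimate h1.le subset_union_left subset_union_left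
    (M := max (S.L1 / 2) ((S.L3 - S.L2) / 2)) (by simp) hε ht
  obtain ⟨D₂, hD₂, hle₂⟩ := sol.multiplier_estimate h23.le subset_union_right subset_union_right
    (M := max (S.L1 / 2) ((S.L3 - S.L2) / 2)) (by simp) hε ht
  refine ⟨-(D₁ + D₂), ?_, ?_⟩
  · convert! (hD₁.add hD₂).neg using 1
    funext s
    simp only [Pi.neg_apply, Pi.add_apply]
    congr 2
    · refine integral_congr fun x hx => ?_
      rw [uIcc_of_le h1.le] at hx
      simp only [qfun_of_le hx.2, zero_add]
    · refine integral_congr fun x hx => ?_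
      rw [uIcc_of_le h23.le] at hx
      simp only [qfun_of_ge h12 hx.1]
  · have hu₁ : 0 ≤ S.L1 * sol.ut 0 t ^ 2 := by positivity
    have hu₂ : 0 ≤ (S.L3 - S.L2) * sol.ut S.L3 t ^ 2 :=
      mul_nonneg (by linarith) (sq_nonneg _)
    have hx₁ : 0 ≤ S.a * (S.L1 * sol.ux 0 t ^ 2) := mul_nonneg S.ha.le (by positivity)
    have hx₂ : 0 ≤ S.a * ((S.L3 - S.L2) * sol.ux S.L3 t ^ 2) :=
      mul_nonneg S.ha.le (mul_nonneg (by linarith) (sq_nonneg _))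
    linarith
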